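/- Suppose ψ(Φ) = r + q for some Φ > 1 − ρ, where r, q > 0, and that ψ(1−ρ) < r + q. Then for all x ≥ b̲: (r + q − ψ(1−ρ)) e^{(1−ρ)x} − (r+q) − (1−ρ) f(x) ≥ ½(1−ρ)σ²Φ ≥ 0, with equality in the first inequality if and only if x = b̲. (Equivalently, χ(x) − q·v̲(x) ≤ −½σ²Φ for all x ≥ b̲, where χ(x) := r/(1−ρ) − ((r − ψ(1−ρ))/(1−ρ)) e^{(1−ρ)x} + f(x).) -/

import Mathlib

open MeasureTheory

/-- CRRA utility evaluated at `e^x`: `U(e^x) = (e^{(1−ρ)x} − 1)/(1−ρ)`. -/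
noncomputable def Ue (ρ x : ℝ) : ℝ := (Real.exp ((1 - ρ) * x) - 1) / (1 - ρ)

/-- The take-profit threshold `b̲ = (1/(1−ρ)) log(Φ/(Φ−1+ρ))`. -/
noncomputable def bLow (ρ Φ : ℝ) : ℝ := (1 / (1 - ρ)) * Real.log (Φ / (Φ - 1 + ρ))

/-- The value function `v̲(x) = e^{Φ(x−b̲)} U(e^{b̲})` for `x ≤ b̲`, and `U(e^x)` for `x > b̲`. -/
noncomputable def vLow (ρ Φ x : ℝ) : ℝ :=
  if x ≤ bLow ρ Φ then Real.exp (Φ * (x - bLow ρ Φ)) * Ue ρ (bLow ρ Φ) else Ue ρ x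

/-- The jump-gap integral `f(x) = ∫_{(−∞,0)} (v̲(x+w) − U(e^{x+w})) ν(dw)`, where `ν` is
the Lévy measure (denoted Π in the paper). -/
noncomputable def fGap (ρ Φ : ℝ) (ν : Measure ℝ) (x : ℝ) : ℝ :=
  ∫ w in Set.Iio (0 : ℝ), (vLow ρ Φ (x + w) - Ue ρ (x + w)) ∂ν

/-- The Laplace exponent of a spectrally negative Lévy process with triplet (μ, σ², ν):
`ψ(β) = μβ + ½σ²β² + ∫_{(−∞,0)} (e^{βw} − 1 − βw·1_{(−1,0)}(w)) ν(dw)`. -/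
noncomputable def laplaceExponent (μ σ : ℝ) (ν : Measure ℝ) (β : ℝ) : ℝ :=
  μ * β + σ ^ 2 * β ^ 2 / 2 +
    ∫ w in Set.Iio (0 : ℝ),
      (Real.exp (β * w) - 1 - (if w ∈ Set.Ioo (-1 : ℝ) 0 then β * w else 0)) ∂ν

/-- `χ(x) = r/(1−ρ) − ((r − ψ(1−ρ))/(1−ρ)) e^{(1−ρ)x} + f(x)`. -/
noncomputable def chiFn (ρ Φ μ σ r : ℝ) (ν : Measure ℝ) (x : ℝ) : ℝ :=
  r / (1 - ρ) - ((r - laplaceExponent μ σ ν (1 - ρ)) / (1 - ρ)) * Real.exp ((1 - ρ) * x) +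
    fGap ρ Φ ν x

lemma exp_sub_one_sub_le_sq {t : ℝ} (ht : t ≤ 0) : Real.exp t - 1 - t ≤ t ^ 2 := by
  have h := Real.quadratic_le_exp_of_nonneg (neg_nonneg.mpr ht)
  have hmul : Real.exp t * Real.exp (-t) = 1 := by rw [← Real.exp_add]; simp
  by_contra! hcon
  have hpos : 0 < 1 + t + t ^ 2 := by nlinarith [sq_nonneg (t + 1 / 2)]
  have h1 : (1 + t + t ^ 2) * (1 + -t + (-t) ^ 2 / 2) ≤ (1 + t + t ^ 2) * Real.exp (-t) :=
    mul_le_mul_of_nonneg_left h hpos.le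
  have h2 : (1 + t + t ^ 2) * Real.exp (-t) < Real.exp t * Real.exp (-t) :=
    mul_lt_mul_of_pos_right (by linarith) (Real.exp_pos _)
  have h3 : 0 ≤ t ^ 2 * (1 - t + t ^ 2) := by
    have : 0 ≤ 1 - t + t ^ 2 := by nlinarith [sq_nonneg t]
    positivity
  nlinarith

/-- The integrand of the Laplace exponent is integrable against a Lévy measure. -/
lemma integrableOn_laplaceExponent_integrand {ν : Measure ℝ} {β : ℝ} (hβ : 0 ≤ β)
    (hν : IntegrableOn (fun w => min 1 (w ^ 2)) (Set.Iio (0 : ℝ)) ν) :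
    IntegrableOn (fun w => Real.exp (β * w) - 1 -
      (if w ∈ Set.Ioo (-1 : ℝ) 0 then β * w else 0)) (Set.Iio 0) ν := by
  refine Integrable.mono' (hν.const_mul (1 + β ^ 2)) ?_ ?_
  · have h : Measurable fun w : ℝ => if w ∈ Set.Ioo (-1 : ℝ) 0 then β * w else 0 :=
      Measurable.ite measurableSet_Ioo (by fun_prop) (by fun_prop)
    exact Measurable.aestronglyMeasurable (by fun_prop)
  · refine (ae_restrict_mem measurableSet_Iio).mono fun w hw => ?_
    have hw0 : w < 0 := hw
    have hβw : β * w ≤ 0 := mul_nonpos_of_nonneg_of_nonpos hβ hw0.le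
    rw [Real.norm_eq_abs]
    split_ifs with h
    · have hmin : min 1 (w ^ 2) = w ^ 2 := min_eq_right (by nlinarith [h.1, h.2])
      rw [hmin, abs_of_nonneg (by linarith [Real.add_one_le_exp (β * w)])]
      nlinarith [exp_sub_one_sub_le_sq hβw, sq_nonneg w]
    · have hw1 : w ≤ -1 := by
        by_contra! hcon
        exact h ⟨hcon, hw0⟩
      have hmin : min 1 (w ^ 2) = 1 := min_eq_left (by nlinarith)
      rw [hmin, abs_le]
      constructor <;>
        nlinarith [Real.exp_pos (β * w), Real.exp_le_one_iff.mpr hβw, sq_nonneg β]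

/-- With `a = 1 - ρ`, the gap `a (v̲ - U ∘ exp)` below the threshold, as a function of the
signed distance to the threshold. -/
noncomputable def lowerGap (a Φ z : ℝ) : ℝ :=
  a / (Φ - a) * Real.exp (Φ * z) - Φ / (Φ - a) * Real.exp (a * z) + 1

lemma lowerGap_zero {a Φ : ℝ} (h : a < Φ) : lowerGap a Φ 0 = 0 := by
  have : Φ - a ≠ 0 := by linarith
  simp only [lowerGap, mul_zero, Real.exp_zero]
  field_simp
  ring

lemma antitoneOn_lowerGap {a Φ : ℝ} (ha : 0 < a) (h : a < Φ) :
    AntitoneOn (lowerGap a Φ) (Set.Iic 0) := by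
  have hd : 0 < Φ - a := by linarith
  have hderiv : ∀ z, HasDerivAt (lowerGap a Φ)
      (a / (Φ - a) * (Real.exp (Φ * z) * Φ) - Φ / (Φ - a) * (Real.exp (a * z) * a)) z := by
    intro z
    have h1 : ∀ c : ℝ, HasDerivAt (fun z => Real.exp (c * z)) (Real.exp (c * z) * c) z := by
      intro c
      simpa using ((hasDerivAt_id z).const_mul c).exp
    exact (((h1 Φ).const_mul _).sub ((h1 a).const_mul _)).add_const 1
  refine antitoneOn_of_deriv_nonpos (convex_Iic 0)
    (fun z _ => (hderiv z).continuousAt.continuousWithinAt)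
    (fun z _ => (hderiv z).differentiableAt.differentiableWithinAt) fun z hz => ?_
  rw [interior_Iic] at hz
  rw [(hderiv z).deriv]
  have hz0 : z < 0 := hz
  have hexp : Real.exp (Φ * z) ≤ Real.exp (a * z) := Real.exp_le_exp.mpr (by nlinarith)
  have heq : a / (Φ - a) * (Real.exp (Φ * z) * Φ) - Φ / (Φ - a) * (Real.exp (a * z) * a) =
      a * Φ / (Φ - a) * (Real.exp (Φ * z) - Real.exp (a * z)) := by ring
  rw [heq]
  have hc : 0 ≤ a * Φ / (Φ - a) := by
    have : 0 < Φ := ha.trans h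
    positivity
  exact mul_nonpos_of_nonneg_of_nonpos hc (by linarith)

/-- `lowerGap` extended by zero above the threshold. -/
noncomputable def utilityGap (a Φ z : ℝ) : ℝ := lowerGap a Φ (min z 0)

lemma antitone_utilityGap {a Φ : ℝ} (ha : 0 < a) (h : a < Φ) : Antitone (utilityGap a Φ) :=
  fun _ _ hxy => antitoneOn_lowerGap ha h (Set.mem_Iic.mpr (min_le_right _ _))
    (Set.mem_Iic.mpr (min_le_right _ _))
    (min_le_min_right 0 hxy)

lemma utilityGap_nonneg {a Φ : ℝ} (ha : 0 < a) (h : a < Φ) (z : ℝ) : 0 ≤ utilityGap a Φ z := by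
  rw [← lowerGap_zero h]
  exact antitoneOn_lowerGap ha h (Set.mem_Iic.mpr (min_le_right _ _)) Set.self_mem_Iic (min_le_right _ _)

lemma exp_mul_bLow {ρ Φ : ℝ} (hρ : 0 < 1 - ρ) (hΦ : 1 - ρ < Φ) :
    Real.exp ((1 - ρ) * bLow ρ Φ) = Φ / (Φ - (1 - ρ)) := by
  have hd : 0 < Φ - (1 - ρ) := by linarith
  have hpos : 0 < Φ / (Φ - (1 - ρ)) := div_pos (hρ.trans hΦ) hd
  have heq : (1 - ρ) * bLow ρ Φ = Real.log (Φ / (Φ - (1 - ρ))) := by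
    rw [bLow, ← mul_assoc, mul_one_div_cancel hρ.ne', one_mul, sub_sub_eq_add_sub,
      sub_add_eq_add_sub]
  rw [heq, Real.exp_log hpos]

lemma vLow_of_bLow_le {ρ Φ x : ℝ} (hx : bLow ρ Φ ≤ x) : vLow ρ Φ x = Ue ρ x := by
  rw [vLow]
  split_ifs with h
  · obtain rfl := le_antisymm h hx
    simp
  · rfl

lemma mul_vLow_sub_Ue {ρ Φ : ℝ} (hρ : 0 < 1 - ρ) (hΦ : 1 - ρ < Φ) (y : ℝ) :
    (1 - ρ) * (vLow ρ Φ y - Ue ρ y) = utilityGap (1 - ρ) Φ (y - bLow ρ Φ) := by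
  rcases le_total y (bLow ρ Φ) with hy | hy
  · have hd : Φ - (1 - ρ) ≠ 0 := by linarith
    have hexp : Real.exp ((1 - ρ) * y) =
        Φ / (Φ - (1 - ρ)) * Real.exp ((1 - ρ) * (y - bLow ρ Φ)) := by
      rw [← exp_mul_bLow hρ hΦ, ← Real.exp_add]
      ring_nf
    rw [utilityGap, min_eq_left (sub_nonpos.mpr hy), lowerGap, ← hexp, vLow, if_pos hy, Ue, Ue,
      exp_mul_bLow hρ hΦ]
    field_simp
    ring
  · rw [utilityGap, min_eq_right (sub_nonneg.mpr hy), lowerGap_zero hΦ, vLow_of_bLow_le hy,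
      sub_self, mul_zero]

lemma mul_fGap {ρ Φ : ℝ} (hρ : 0 < 1 - ρ) (hΦ : 1 - ρ < Φ) (ν : Measure ℝ) (x : ℝ) :
    (1 - ρ) * fGap ρ Φ ν x =
      ∫ w in Set.Iio (0 : ℝ), utilityGap (1 - ρ) Φ (x + w - bLow ρ Φ) ∂ν := by
  simp_rw [fGap, ← integral_const_mul, mul_vLow_sub_Ue hρ hΦ]

lemma lowerGap_eq_integrands {a Φ : ℝ} (h : a < Φ) (w : ℝ) :
    lowerGap a Φ w =
      a / (Φ - a) * (Real.exp (Φ * w) - 1 - (if w ∈ Set.Ioo (-1 : ℝ) 0 then Φ * w else 0)) -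
      Φ / (Φ - a) * (Real.exp (a * w) - 1 - (if w ∈ Set.Ioo (-1 : ℝ) 0 then a * w else 0)) := by
  have hd : Φ - a ≠ 0 := by linarith
  rw [lowerGap]
  split_ifs <;> field_simp <;> ring

lemma integrableOn_lowerGap {a Φ : ℝ} (ha : 0 < a) (h : a < Φ) {ν : Measure ℝ}
    (hν : IntegrableOn (fun w => min 1 (w ^ 2)) (Set.Iio (0 : ℝ)) ν) :
    IntegrableOn (lowerGap a Φ) (Set.Iio 0) ν := by
  rw [funext (lowerGap_eq_integrands h)]
  exact ((integrableOn_laplaceExponent_integrand (ha.trans h).le hν).const_mul _).sub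
    ((integrableOn_laplaceExponent_integrand ha.le hν).const_mul _)

/-- The drift and jump compensators cancel in this combination of Laplace exponents. -/
lemma integral_lowerGap {a Φ : ℝ} (ha : 0 < a) (h : a < Φ) {ν : Measure ℝ}
    (hν : IntegrableOn (fun w => min 1 (w ^ 2)) (Set.Iio (0 : ℝ)) ν) (μ σ : ℝ) :
    ∫ w in Set.Iio (0 : ℝ), lowerGap a Φ w ∂ν =
      a / (Φ - a) * laplaceExponent μ σ ν Φ - Φ / (Φ - a) * laplaceExponent μ σ ν a -
        σ ^ 2 * a * Φ / 2 := by
  have hd : Φ - a ≠ 0 := by linarith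
  simp_rw [lowerGap_eq_integrands h]
  rw [integral_sub ((integrableOn_laplaceExponent_integrand (ha.trans h).le hν).const_mul _)
    ((integrableOn_laplaceExponent_integrand ha.le hν).const_mul _), integral_const_mul,
    integral_const_mul, laplaceExponent, laplaceExponent]
  field_simp
  ring

lemma mul_fGap_bLow {ρ Φ : ℝ} (hρ : 0 < 1 - ρ) (hΦ : 1 - ρ < Φ) (ν : Measure ℝ) :
    (1 - ρ) * fGap ρ Φ ν (bLow ρ Φ) = ∫ w in Set.Iio (0 : ℝ), lowerGap (1 - ρ) Φ w ∂ν := by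
  rw [mul_fGap hρ hΦ]
  refine setIntegral_congr_fun measurableSet_Iio fun w hw => ?_
  have hw0 : w < 0 := hw
  simp only [add_sub_cancel_left, utilityGap, min_eq_left hw0.le]

lemma mul_fGap_le {ρ Φ : ℝ} (hρ : 0 < 1 - ρ) (hΦ : 1 - ρ < Φ) {ν : Measure ℝ}
    (hν : IntegrableOn (fun w => min 1 (w ^ 2)) (Set.Iio (0 : ℝ)) ν) {x : ℝ}
    (hx : bLow ρ Φ ≤ x) :
    (1 - ρ) * fGap ρ Φ ν x ≤ (1 - ρ) * fGap ρ Φ ν (bLow ρ Φ) := by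
  rw [mul_fGap_bLow hρ hΦ, mul_fGap hρ hΦ]
  refine integral_mono_of_nonneg (.of_forall fun w => utilityGap_nonneg hρ hΦ _)
    (integrableOn_lowerGap hρ hΦ hν) ?_
  refine (ae_restrict_mem measurableSet_Iio).mono fun w hw => ?_
  have hw0 : w < 0 := hw
  have hle := antitone_utilityGap hρ hΦ (show w ≤ x + w - bLow ρ Φ by linarith)
  rwa [utilityGap, utilityGap, min_eq_left hw0.le] at hle

/-- Suppose ψ(Φ) = r + q for some Φ > 1 − ρ, with r, q > 0, and
ψ(1−ρ) < r + q. Then for all x ≥ b̲: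
(r + q − ψ(1−ρ)) e^{(1−ρ)x} − (r+q) − (1−ρ) f(x) ≥ ½(1−ρ)σ²Φ ≥ 0,
with equality in the first inequality iff x = b̲. Equivalently,
χ(x) − q·v̲(x) ≤ −½σ²Φ for all x ≥ b̲. -/
theorem drift_gap_lower_bound
    (ρ Φ μ σ r q : ℝ) (hρ : ρ ∈ Set.Ico (0 : ℝ) 1) (hΦ : 1 - ρ < Φ)
    (hσ : 0 ≤ σ) (hr : 0 < r) (hq : 0 < q)
    (ν : Measure ℝ)
    (hν : IntegrableOn (fun w => min 1 (w ^ 2)) (Set.Iio (0 : ℝ)) ν)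
    (hψΦ : laplaceExponent μ σ ν Φ = r + q)
    (hψρ : laplaceExponent μ σ ν (1 - ρ) < r + q) :
    (∀ x : ℝ, bLow ρ Φ ≤ x →
      (1 / 2) * (1 - ρ) * σ ^ 2 * Φ ≤
        (r + q - laplaceExponent μ σ ν (1 - ρ)) * Real.exp ((1 - ρ) * x) - (r + q) -
          (1 - ρ) * fGap ρ Φ ν x) ∧
    (0 ≤ (1 / 2) * (1 - ρ) * σ ^ 2 * Φ) ∧
    (∀ x : ℝ, bLow ρ Φ ≤ x →
      ((r + q - laplaceExponent μ σ ν (1 - ρ)) * Real.exp ((1 - ρ) * x) - (r + q) -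
          (1 - ρ) * fGap ρ Φ ν x = (1 / 2) * (1 - ρ) * σ ^ 2 * Φ ↔ x = bLow ρ Φ)) ∧
    (∀ x : ℝ, bLow ρ Φ ≤ x →
      chiFn ρ Φ μ σ r ν x - q * vLow ρ Φ x ≤ -(σ ^ 2 * Φ / 2)) := by
  have ha : 0 < 1 - ρ := sub_pos.mpr hρ.2
  have hd : 0 < Φ - (1 - ρ) := by linarith
  set b := bLow ρ Φ with hb
  set A := r + q - laplaceExponent μ σ ν (1 - ρ) with hA
  have hApos : 0 < A := by linarith
  have heq : A * Real.exp ((1 - ρ) * b) - (r + q) - (1 - ρ) * fGap ρ Φ ν b =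
      (1 / 2) * (1 - ρ) * σ ^ 2 * Φ := by
    rw [hb, exp_mul_bLow ha hΦ, mul_fGap_bLow ha hΦ, integral_lowerGap ha hΦ hν μ σ, hψΦ, hA]
    field_simp
    ring
  have hlt : ∀ x, b < x → (1 / 2) * (1 - ρ) * σ ^ 2 * Φ <
      A * Real.exp ((1 - ρ) * x) - (r + q) - (1 - ρ) * fGap ρ Φ ν x := by
    intro x hx
    have hf := mul_fGap_le ha hΦ hν hx.le
    have hexp : A * Real.exp ((1 - ρ) * b) < A * Real.exp ((1 - ρ) * x) :=
      mul_lt_mul_of_pos_left (Real.exp_lt_exp.mpr (mul_lt_mul_of_pos_left hx ha)) hApos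
    linarith
  have hle : ∀ x, b ≤ x → (1 / 2) * (1 - ρ) * σ ^ 2 * Φ ≤
      A * Real.exp ((1 - ρ) * x) - (r + q) - (1 - ρ) * fGap ρ Φ ν x := by
    intro x hx
    rcases hx.eq_or_lt with rfl | hx
    · exact heq.ge
    · exact (hlt x hx).le
  have hΦpos : 0 < Φ := ha.trans hΦ
  refine ⟨hle, by positivity, fun x hx => ⟨fun h => ?_, fun h => h ▸ heq⟩, fun x hx => ?_⟩
  · by_contra hne
    exact (hlt x (lt_of_le_of_ne hx (Ne.symm hne))).ne' h
  · have hchi : (1 - ρ) * (chiFn ρ Φ μ σ r ν x - q * vLow ρ Φ x) =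
        -(A * Real.exp ((1 - ρ) * x) - (r + q) - (1 - ρ) * fGap ρ Φ ν x) := by
      rw [vLow_of_bLow_le hx, chiFn, Ue, hA]
      field_simp
      ring
    refine le_of_mul_le_mul_left ?_ ha
    rw [hchi]
    linarith [hle x hx]
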